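/- arXiv:2107.00331 — 3 statements merged into one kernel-verified Lean document; each statement's English description precedes it below -/
import Mathlib

section
/- For every r ≥ 1 and every v ∈ C_c^∞(Ω_r), one has ∫_{Ω_r} |v(x)| dx ≤ 2^{N−1} ∫_{Ω_r} |∇v(x)| dx. -/
open Set MeasureTheory

theorem lintegral_comp_smul_le_of_one_le {E : Type*} [NormedAddCommGroup E] [NormedSpace ℝ E]
    [MeasurableSpace E] [BorelSpace E] [FiniteDimensional ℝ E] (μ : Measure E)
    [μ.IsAddHaarMeasure] {f : E → ENNReal} (hf : Measurable f) {c : ℝ} (hc : 1 ≤ c) :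
    ∫⁻ x, f (c • x) ∂μ ≤ ∫⁻ x, f x ∂μ := by
  rw [← lintegral_map (g := fun x : E => c • x) hf (measurable_const_smul c),
    Measure.map_addHaar_smul μ (by positivity), lintegral_smul_measure]
  refine mul_le_of_le_one_left zero_le ?_
  rw [ENNReal.ofReal_le_one, abs_of_nonneg (by positivity)]
  exact inv_le_one_of_one_le₀ (one_le_pow₀ hc)

/-- A radial fundamental theorem of calculus: if `v` vanishes at `2 • x`, then `v x` is controlled
by the derivative of `v` along the segment from `x` to `2 • x`. -/
theorem enorm_le_lintegral_fderiv_smul {E : Type*} [NormedAddCommGroup E] [NormedSpace ℝ E]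
    {v : E → ℝ} (hv : ContDiff ℝ 1 v) {x : E} (hx : v ((2 : ℝ) • x) = 0) :
    ‖v x‖ₑ ≤ ∫⁻ c in Ioc (1 : ℝ) 2, ‖fderiv ℝ v (c • x)‖ₑ * ‖x‖ₑ := by
  have hd : ∀ c : ℝ, HasDerivAt (fun c : ℝ => v (c • x)) (fderiv ℝ v (c • x) x) c := fun c => by
    have h := ((hv.differentiable one_ne_zero) (c • x)).hasFDerivAt.comp_hasDerivAt c
      ((hasDerivAt_id c).smul_const x)
    rw [one_smul] at h
    exact h
  have hcont : Continuous fun c : ℝ => fderiv ℝ v (c • x) x :=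
    ((hv.continuous_fderiv one_ne_zero).comp (by fun_prop)).clm_apply continuous_const
  have hint := intervalIntegral.integral_eq_sub_of_hasDerivAt (a := 1) (b := 2)
    (fun c _ => hd c) (hcont.intervalIntegrable _ _)
  rw [hx, one_smul, zero_sub, intervalIntegral.integral_of_le one_le_two] at hint
  rw [← enorm_neg, ← hint]
  refine (enorm_integral_le_lintegral_enorm _).trans (lintegral_mono fun c => ?_)
  exact ContinuousLinearMap.le_opENorm _ _

/-- The `L¹` Poincaré inequality on an annulus of inner radius at least one and unit width. -/
theorem lintegral_enorm_annulus_le {E : Type*} [NormedAddCommGroup E] [NormedSpace ℝ E]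
    [MeasurableSpace E] [BorelSpace E] [FiniteDimensional ℝ E] (μ : Measure E)
    [μ.IsAddHaarMeasure] {r : ℝ} (hr : 1 ≤ r) {v : E → ℝ} (hv : ContDiff ℝ 1 v)
    (hsupp : tsupport v ⊆ {x | r < ‖x‖ ∧ ‖x‖ < r + 1}) :
    ∫⁻ x in {x | r < ‖x‖ ∧ ‖x‖ < r + 1}, ‖v x‖ₑ ∂μ ≤
      2 * ∫⁻ x in {x | r < ‖x‖ ∧ ‖x‖ < r + 1}, ‖fderiv ℝ v x‖ₑ ∂μ := by
  have hr0 : 0 < r := by linarith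
  set Ω : Set E := {x | r < ‖x‖ ∧ ‖x‖ < r + 1}
  have hΩ : MeasurableSet Ω :=
    (measurableSet_lt measurable_const measurable_norm).inter
      (measurableSet_lt measurable_norm measurable_const)
  have hg : Measurable fun y => ‖fderiv ℝ v y‖ₑ :=
    (hv.continuous_fderiv one_ne_zero).enorm.measurable
  let A : Set (ℝ × E) := {p | r * p.1 < ‖p.2‖}
  have hA : MeasurableSet A := measurableSet_lt (by fun_prop) (by fun_prop)
  let F : ℝ → E → ENNReal := fun c y => A.indicator (fun p => ‖fderiv ℝ v p.2‖ₑ * ‖p.2‖ₑ) (c, y)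
  have hF : Measurable (Function.uncurry F) := by
    refine Measurable.indicator ?_ hA
    exact (hg.comp measurable_snd).mul measurable_snd.enorm
  have hFs : Measurable fun p : E × ℝ => F p.2 (p.2 • p.1) := by
    have : Measurable fun p : E × ℝ => (p.2, p.2 • p.1) := by fun_prop
    exact hF.comp this
  have hpoint : ∀ x ∈ Ω, ‖v x‖ₑ ≤ ∫⁻ c in Ioc (1 : ℝ) 2, F c (c • x) := by
    intro x hx
    have h2 : v ((2 : ℝ) • x) = 0 := by
      refine image_eq_zero_of_notMem_tsupport fun h => ?_
      have h1 := (hsupp h).2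
      rw [norm_smul, Real.norm_ofNat] at h1
      linarith [hx.1]
    refine (enorm_le_lintegral_fderiv_smul hv h2).trans
      (setLIntegral_mono' measurableSet_Ioc fun c hc => ?_)
    have hc0 : 0 < c := by linarith [hc.1]
    have hmem : (c, c • x) ∈ A := by
      change r * c < ‖c • x‖
      rw [norm_smul, Real.norm_of_nonneg hc0.le]
      nlinarith [hx.1]
    simp only [F, indicator_of_mem hmem]
    gcongr
    rw [enorm_le_iff_norm_le, norm_smul, Real.norm_of_nonneg hc0.le]
    nlinarith [norm_nonneg x, hc.1]
  have hfiber : ∀ y,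
      ∫⁻ c in Ioc (1 : ℝ) 2, F c y ≤ Ω.indicator (fun y => 2 * ‖fderiv ℝ v y‖ₑ) y := by
    intro y
    by_cases hy : y ∈ Ω
    · rw [indicator_of_mem hy]
      calc ∫⁻ c in Ioc (1 : ℝ) 2, F c y
          ≤ ∫⁻ c, (Ioc 1 (‖y‖ / r)).indicator (fun _ => ‖fderiv ℝ v y‖ₑ * ‖y‖ₑ) c := by
            rw [← lintegral_indicator measurableSet_Ioc]
            refine lintegral_mono fun c => ?_
            refine indicator_le (fun c hc => ?_) c
            by_cases h : (c, y) ∈ A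
            · have : c ∈ Ioc 1 (‖y‖ / r) :=
                ⟨hc.1, by rw [le_div_iff₀ hr0, mul_comm]; exact le_of_lt h⟩
              simp [F, h, this]
            · simp [F, h]
        _ = ‖fderiv ℝ v y‖ₑ * (‖y‖ₑ * ENNReal.ofReal (‖y‖ / r - 1)) := by
            rw [lintegral_indicator_const measurableSet_Ioc, Real.volume_Ioc, mul_assoc]
        _ ≤ ‖fderiv ℝ v y‖ₑ * 2 := by
            gcongr
            rw [← ofReal_norm, ← ENNReal.ofReal_mul (norm_nonneg y)]
            refine ENNReal.ofReal_le_of_le_toReal ?_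
            rw [ENNReal.toReal_ofNat, ← mul_le_mul_iff_left₀ hr0]
            have : ‖y‖ * (‖y‖ / r - 1) * r = ‖y‖ * (‖y‖ - r) := by field_simp
            rw [this]
            nlinarith [hy.1, hy.2]
        _ = 2 * ‖fderiv ℝ v y‖ₑ := mul_comm _ _
    · have h0 : ‖fderiv ℝ v y‖ₑ = 0 := by
        rw [← ofReal_norm, ENNReal.ofReal_eq_zero, norm_le_zero_iff]
        exact image_eq_zero_of_notMem_tsupport fun h => hy (hsupp (tsupport_fderiv_subset ℝ h))
      have : ∀ c, F c y = 0 := fun c =>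
        indicator_apply_eq_zero.mpr fun _ => by simp only [h0, zero_mul]
      simp [this]
  calc ∫⁻ x in Ω, ‖v x‖ₑ ∂μ
      ≤ ∫⁻ x in Ω, (∫⁻ c in Ioc (1 : ℝ) 2, F c (c • x)) ∂μ := setLIntegral_mono' hΩ hpoint
    _ ≤ ∫⁻ x, (∫⁻ c in Ioc (1 : ℝ) 2, F c (c • x)) ∂μ := setLIntegral_le_lintegral _ _
    _ = ∫⁻ c in Ioc (1 : ℝ) 2, ∫⁻ x, F c (c • x) ∂μ := lintegral_lintegral_swap hFs.aemeasurable
    _ ≤ ∫⁻ c in Ioc (1 : ℝ) 2, ∫⁻ y, F c y ∂μ :=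
        setLIntegral_mono' measurableSet_Ioc fun c hc =>
          lintegral_comp_smul_le_of_one_le μ hF.of_uncurry_left hc.1.le
    _ = ∫⁻ y, (∫⁻ c in Ioc (1 : ℝ) 2, F c y) ∂μ := lintegral_lintegral_swap hF.aemeasurable
    _ ≤ ∫⁻ y, Ω.indicator (fun y => 2 * ‖fderiv ℝ v y‖ₑ) y ∂μ := lintegral_mono hfiber
    _ = 2 * ∫⁻ y in Ω, ‖fderiv ℝ v y‖ₑ ∂μ := by
        rw [lintegral_indicator hΩ, lintegral_const_mul _ hg]

/-- For the annulus `Ω_r = {x ∈ ℝ^N : r < |x| < r+1}`, every `r ≥ 1` and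
every `v ∈ C_c^∞(Ω_r)` satisfy `∫_{Ω_r} |v| ≤ 2^(N-1) ∫_{Ω_r} |∇v|`. -/
theorem stmt2 (N : ℕ) (hN : 2 ≤ N) :
    ∀ r : ℝ, 1 ≤ r →
      ∀ v : EuclideanSpace ℝ (Fin N) → ℝ,
        ContDiff ℝ (⊤ : ℕ∞) v → HasCompactSupport v →
        tsupport v ⊆ {x : EuclideanSpace ℝ (Fin N) | r < ‖x‖ ∧ ‖x‖ < r + 1} →
        ∫ x in {x : EuclideanSpace ℝ (Fin N) | r < ‖x‖ ∧ ‖x‖ < r + 1}, |v x| ≤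
          2 ^ (N - 1) *
            ∫ x in {x : EuclideanSpace ℝ (Fin N) | r < ‖x‖ ∧ ‖x‖ < r + 1}, ‖fderiv ℝ v x‖ := by
  intro r hr v hv hcs hsupp
  have hv1 : ContDiff ℝ 1 v := hv.of_le (mod_cast le_top)
  have hcont : Continuous (fderiv ℝ v) := hv1.continuous_fderiv one_ne_zero
  have hint : Integrable (fderiv ℝ v) := hcont.integrable_of_hasCompactSupport (hcs.fderiv ℝ)
  have hmain := lintegral_enorm_annulus_le volume hr hv1 hsupp
  simp_rw [← Real.norm_eq_abs]
  rw [integral_norm_eq_lintegral_enorm hv.continuous.aestronglyMeasurable,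
    integral_norm_eq_lintegral_enorm hcont.aestronglyMeasurable]
  have hfin := hint.integrableOn (s := {x | r < ‖x‖ ∧ ‖x‖ < r + 1}).2.ne
  have h2 : (2 : ℝ) ≤ 2 ^ (N - 1) := le_self_pow₀ one_le_two (by omega)
  calc _ ≤ _ := ENNReal.toReal_mono (ENNReal.mul_ne_top ENNReal.ofNat_ne_top hfin) hmain
    _ = 2 * _ := by rw [ENNReal.toReal_mul, ENNReal.toReal_ofNat]
    _ ≤ _ := mul_le_mul_of_nonneg_right h2 ENNReal.toReal_nonneg
end

section
/- Let p > 1. For every r > 0 and every v ∈ C_c^∞(Ω_r), one has ∫_{Ω_r} |v(x)|^p dx ≤ ((r+1)/r)^{N−1} ∫_{Ω_r} |∇v(x)|^p dx. -/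
open Set MeasureTheory

/-- Integration in polar coordinates for the Lebesgue integral. -/
theorem lintegral_eq_lintegral_toSphere {E : Type*} [NormedAddCommGroup E] [NormedSpace ℝ E]
    [FiniteDimensional ℝ E] [Nontrivial E] [MeasurableSpace E] [BorelSpace E]
    (μ : Measure E) [μ.IsAddHaarMeasure] {f : E → ENNReal} (hf : Measurable f) :
    ∫⁻ x, f x ∂μ = ∫⁻ ω : Metric.sphere (0 : E) 1, (∫⁻ s in Ioi (0 : ℝ),
      ENNReal.ofReal (s ^ (Module.finrank ℝ E - 1)) * f (s • (ω : E))) ∂μ.toSphere := by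
  have hsymm : Measurable fun z : Metric.sphere (0 : E) 1 × Ioi (0 : ℝ) ↦
      f ((z.2 : ℝ) • (z.1 : E)) := by
    refine hf.comp (Continuous.measurable ?_)
    fun_prop
  calc
    ∫⁻ x, f x ∂μ = ∫⁻ x : ({0}ᶜ : Set E), f x ∂(μ.comap (↑)) := by
      rw [lintegral_subtype_comap (measurableSet_singleton _).compl f,
        restrict_compl_singleton]
    _ = ∫⁻ z, f ((z.2 : ℝ) • (z.1 : E))
          ∂μ.toSphere.prod (.volumeIoiPow (Module.finrank ℝ E - 1)) := by
      rw [← μ.measurePreserving_homeomorphUnitSphereProd.lintegral_comp hsymm]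
      refine lintegral_congr fun x ↦ ?_
      have hx : ‖(x : E)‖ ≠ 0 := norm_ne_zero_iff.2 x.2
      simp [smul_smul, hx]
    _ = _ := by
      rw [lintegral_prod _ hsymm.aemeasurable]
      refine lintegral_congr fun ω ↦ ?_
      rw [← lintegral_subtype_comap measurableSet_Ioi]
      exact lintegral_withDensity_eq_lintegral_mul _ (by fun_prop)
        (hsymm.comp measurable_prodMk_left)

/-- A one-dimensional Poincaré inequality on an interval of length one, in pointwise form. -/
theorem abs_rpow_le_integral_rpow_of_hasDerivAt {p a : ℝ} (hp : 1 ≤ p) {u u' w : ℝ → ℝ}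
    (hu : ∀ t, HasDerivAt u (u' t) t) (hu' : Continuous u') (hw : Continuous w)
    (hle : ∀ t, |u' t| ≤ w t) (ha : u a = 0) {t : ℝ} (ht : t ∈ Ioc a (a + 1)) :
    |u t| ^ p ≤ ∫ s in Ioc a (a + 1), w s ^ p := by
  have hw0 : ∀ s, 0 ≤ w s := fun s ↦ (abs_nonneg _).trans (hle s)
  have hftc : ∫ s in a..t, u' s = u t := by
    rw [intervalIntegral.integral_eq_sub_of_hasDerivAt (fun x _ ↦ hu x)
      (hu'.intervalIntegrable _ _), ha, sub_zero]
  have hint : IntegrableOn w (Ioc a (a + 1)) := hw.integrableOn_Ioc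
  have h1 : |u t| ≤ ∫ s in Ioc a (a + 1), w s := by
    rw [← hftc, ← Real.norm_eq_abs]
    refine (intervalIntegral.norm_integral_le_of_norm_le ht.1.le (.of_forall fun s _ ↦ hle s)
      (hw.intervalIntegrable _ _)).trans ?_
    rw [intervalIntegral.integral_of_le ht.1.le]
    exact setIntegral_mono_set hint (.of_forall hw0) (Ioc_subset_Ioc_right ht.2).eventuallyLE
  have : IsProbabilityMeasure (volume.restrict (Ioc a (a + 1))) := ⟨by simp⟩
  have hwp : Continuous fun s ↦ w s ^ p :=
    hw.rpow_const fun _ ↦ .inr (zero_le_one.trans hp)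
  calc
    |u t| ^ p ≤ (∫ s in Ioc a (a + 1), w s) ^ p := by gcongr
    _ ≤ ∫ s in Ioc a (a + 1), w s ^ p :=
      (convexOn_rpow hp).map_integral_le
        (Real.continuous_rpow_const (zero_le_one.trans hp)).continuousOn isClosed_Ici
        (.of_forall hw0) hint hwp.integrableOn_Ioc

/-- A one-dimensional Poincaré inequality on an interval of length one, with weight `s ^ n`. -/
theorem lintegral_pow_mul_rpow_le {p r : ℝ} (hp : 1 ≤ p) (hr : 0 < r) (n : ℕ) {u u' w : ℝ → ℝ}
    (hu : ∀ t, HasDerivAt u (u' t) t) (hu' : Continuous u') (hw : Continuous w)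
    (hle : ∀ t, |u' t| ≤ w t) (hsupp : ∀ t, 0 < t → t ∉ Ioo r (r + 1) → u t = 0) :
    ∫⁻ s in Ioi (0 : ℝ), ENNReal.ofReal (s ^ n) * ENNReal.ofReal (|u s| ^ p) ≤
      ENNReal.ofReal (((r + 1) / r) ^ n) *
        ∫⁻ s in Ioi (0 : ℝ), ENNReal.ofReal (s ^ n) * ENNReal.ofReal (w s ^ p) := by
  have hp0 : 0 < p := one_pos.trans_le hp
  have hw0 : ∀ s, 0 ≤ w s := fun s ↦ (abs_nonneg _).trans (hle s)
  have hsub : Ioc r (r + 1) ⊆ Ioi 0 := fun s hs ↦ hr.trans hs.1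
  have hwp : Continuous fun s ↦ w s ^ p := hw.rpow_const fun _ ↦ .inr hp0.le
  have hI : ENNReal.ofReal (∫ s in Ioc r (r + 1), w s ^ p) =
      ∫⁻ s in Ioc r (r + 1), ENNReal.ofReal (w s ^ p) :=
    ofReal_integral_eq_lintegral_ofReal hwp.integrableOn_Ioc
      (.of_forall fun s ↦ Real.rpow_nonneg (hw0 s) p)
  calc
    _ = ∫⁻ s in Ioc r (r + 1), ENNReal.ofReal (s ^ n) * ENNReal.ofReal (|u s| ^ p) := by
      rw [← lintegral_inter_add_sdiff _ (Ioi 0) measurableSet_Ioc, inter_eq_right.2 hsub,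
        setLIntegral_eq_zero (measurableSet_Ioi.diff measurableSet_Ioc), add_zero]
      intro s hs
      have hus : u s = 0 := hsupp s hs.1 fun h ↦ hs.2 (Ioo_subset_Ioc_self h)
      simp [hus, hp0.ne']
    _ ≤ ∫⁻ _ in Ioc r (r + 1), ENNReal.ofReal ((r + 1) ^ n) *
          ENNReal.ofReal (∫ s in Ioc r (r + 1), w s ^ p) := by
      refine setLIntegral_mono' measurableSet_Ioc fun s hs ↦ ?_
      have hs0 : 0 ≤ s := (hsub hs).le
      gcongr
      · exact hs.2
      · exact abs_rpow_le_integral_rpow_of_hasDerivAt hp hu hu' hw hle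
          (hsupp r hr fun h ↦ h.1.false) hs
    _ = ∫⁻ s in Ioc r (r + 1), ENNReal.ofReal ((r + 1) ^ n) * ENNReal.ofReal (w s ^ p) := by
      rw [hI, lintegral_const_mul _ hwp.measurable.ennreal_ofReal]
      simp
    _ ≤ ∫⁻ s in Ioc r (r + 1), ENNReal.ofReal (((r + 1) / r) ^ n) *
          (ENNReal.ofReal (s ^ n) * ENNReal.ofReal (w s ^ p)) := by
      refine setLIntegral_mono' measurableSet_Ioc fun s hs ↦ ?_
      rw [← mul_assoc, ← ENNReal.ofReal_mul (p := _ ^ n) (q := s ^ n) (by positivity), ← mul_pow]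
      gcongr
      rw [div_mul_eq_mul_div, le_div_iff₀ hr]
      exact mul_le_mul_of_nonneg_left hs.1.le (by positivity)
    _ = ENNReal.ofReal (((r + 1) / r) ^ n) *
          ∫⁻ s in Ioc r (r + 1), ENNReal.ofReal (s ^ n) * ENNReal.ofReal (w s ^ p) :=
      lintegral_const_mul _ (by fun_prop)
    _ ≤ _ := by gcongr

/-- For `p > 1`, the annulus `Ω_r = {x ∈ ℝ^N : r < |x| < r+1}`, every `r > 0`
and every `v ∈ C_c^∞(Ω_r)`:
`∫_{Ω_r} |v|^p ≤ ((r+1)/r)^(N-1) ∫_{Ω_r} |∇v|^p`. -/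
theorem stmt3 (N : ℕ) (hN : 2 ≤ N) (p : ℝ) (hp : 1 < p) :
    ∀ r : ℝ, 0 < r →
      ∀ v : EuclideanSpace ℝ (Fin N) → ℝ,
        ContDiff ℝ (⊤ : ℕ∞) v → HasCompactSupport v →
        tsupport v ⊆ {x : EuclideanSpace ℝ (Fin N) | r < ‖x‖ ∧ ‖x‖ < r + 1} →
        ∫ x in {x : EuclideanSpace ℝ (Fin N) | r < ‖x‖ ∧ ‖x‖ < r + 1}, |v x| ^ p ≤
          ((r + 1) / r) ^ (N - 1) *
            ∫ x in {x : EuclideanSpace ℝ (Fin N) | r < ‖x‖ ∧ ‖x‖ < r + 1}, ‖fderiv ℝ v x‖ ^ p := by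
  intro r hr v hv hc hs
  have hp0 : 0 < p := one_pos.trans hp
  have : Nonempty (Fin N) := ⟨⟨0, by lia⟩⟩
  have hdv : Continuous (fderiv ℝ v) := hv.continuous_fderiv (by simp)
  have hv0 : ∀ x, ¬(r < ‖x‖ ∧ ‖x‖ < r + 1) → v x = 0 := fun x hx ↦
    image_eq_zero_of_notMem_tsupport fun h ↦ hx (hs h)
  have hdv0 : ∀ x, ¬(r < ‖x‖ ∧ ‖x‖ < r + 1) → fderiv ℝ v x = 0 := fun x hx ↦
    image_eq_zero_of_notMem_tsupport fun h ↦ hx (hs (tsupport_fderiv_subset ℝ h))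
  have hgc : Continuous fun x ↦ ‖fderiv ℝ v x‖ ^ p :=
    hdv.norm.rpow_const fun _ ↦ .inr hp0.le
  have hfc : Continuous fun x ↦ |v x| ^ p :=
    hv.continuous.abs.rpow_const fun _ ↦ .inr hp0.le
  have hgi : Integrable fun x ↦ ‖fderiv ℝ v x‖ ^ p :=
    hgc.integrable_of_hasCompactSupport <|
      (hc.fderiv ℝ).comp_left (g := fun L ↦ ‖L‖ ^ p) (by simp [hp0.ne'])
  rw [setIntegral_eq_integral_of_forall_compl_eq_zero
      (fun x hx ↦ by rw [hv0 x hx]; simp [hp0.ne']),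
    setIntegral_eq_integral_of_forall_compl_eq_zero
      (fun x hx ↦ by rw [hdv0 x hx]; simp [hp0.ne'])]
  have hK : 0 ≤ ((r + 1) / r) ^ (N - 1) := by positivity
  rw [integral_eq_lintegral_of_nonneg_ae (.of_forall fun x ↦ by positivity)
    hfc.aestronglyMeasurable]
  refine ENNReal.toReal_le_of_le_ofReal
    (mul_nonneg hK (integral_nonneg fun x ↦ by positivity)) ?_
  rw [ENNReal.ofReal_mul hK, ofReal_integral_eq_lintegral_ofReal hgi
      (.of_forall fun x ↦ by positivity),
    lintegral_eq_lintegral_toSphere volume hfc.measurable.ennreal_ofReal,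
    lintegral_eq_lintegral_toSphere volume hgc.measurable.ennreal_ofReal,
    ← lintegral_const_mul' _ _ ENNReal.ofReal_ne_top, finrank_euclideanSpace_fin]
  refine lintegral_mono fun ω ↦ ?_
  have hω : ‖(ω : EuclideanSpace ℝ (Fin N))‖ = 1 := by simp
  refine lintegral_pow_mul_rpow_le hp.le hr (N - 1)
    (u := fun s ↦ v (s • (ω : EuclideanSpace ℝ (Fin N))))
    (u' := fun s ↦ fderiv ℝ v (s • (ω : EuclideanSpace ℝ (Fin N))) ω)
    (w := fun s ↦ ‖fderiv ℝ v (s • (ω : EuclideanSpace ℝ (Fin N)))‖) (fun t ↦ ?_)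
    (by fun_prop) (by fun_prop) (fun t ↦ ?_) fun t ht htr ↦ ?_
  · have h := ((hv.differentiable (by simp)) (t • (ω : EuclideanSpace ℝ (Fin N)))).hasFDerivAt
    have h' := (hasDerivAt_id t).smul_const (ω : EuclideanSpace ℝ (Fin N))
    rw [one_smul] at h'
    exact h.comp_hasDerivAt t h'
  · simpa [hω] using (fderiv ℝ v (t • (ω : EuclideanSpace ℝ (Fin N)))).le_opNorm ω
  · refine hv0 _ fun h ↦ htr ?_
    simpa [norm_smul, hω, abs_of_pos ht] using h
end

section
/- Let Ω ⊂ ℝ^N be a bounded measurable set written as Ω = Ω_N ∪ Ω_q ∪ Ω_p with Ω_N, Ω_q, Ω_p measurable sets, each of positive Lebesgue measure. Let β, q₂, ζ ∈ [1,∞) and set m = max{β, q₂, ζ}. Let V be a finite-dimensional subspace of L^m(Ω). Then there exists a constant C > 0 such that ∫_{Ω_N} |u|^β dx + ∫_{Ω_q} |u|^{q₂} dx + ∫_{Ω_p} |u|^ζ dx ≥ C for every u ∈ V with ‖u‖_{L^m(Ω)} = 1. -/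
open Set MeasureTheory

/-- A measurable function in `L^p` of a finite measure `μ` lies in `L^r` of every smaller measure,
for `r ≤ p`. -/
lemma memLp_coe_of_le {α : Type*} [MeasurableSpace α] {μ ν : Measure α} [IsFiniteMeasure μ]
    (hνμ : ν ≤ μ) {p r : ENNReal} (hrp : r ≤ p) (u : Lp ℝ p μ) : MemLp u r ν :=
  ((Lp.memLp u).mono_exponent hrp).mono_measure hνμ

/-- On a finite measure space, `u ↦ ∫ |u| ^ r ∂ν` is continuous on `L^p(μ)` for `1 ≤ r ≤ p`
and `ν ≤ μ`. -/
lemma continuous_integral_abs_rpow {α : Type*} [MeasurableSpace α] {μ ν : Measure α}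
    [IsFiniteMeasure μ] (hνμ : ν ≤ μ) {r : ℝ} (hr : 1 ≤ r) {p : ENNReal} [Fact (1 ≤ p)]
    (hrp : ENNReal.ofReal r ≤ p) :
    Continuous fun u : Lp ℝ p μ => ∫ x, |u x| ^ r ∂ν := by
  have hr0 : 0 < r := by linarith
  have hr1 : 1 ≤ ENNReal.ofReal r := by simpa using hr
  have : Fact (1 ≤ ENNReal.ofReal r) := ⟨hr1⟩
  have hmem := memLp_coe_of_le hνμ hrp
  let T : Lp ℝ p μ → Lp ℝ (ENNReal.ofReal r) ν := fun u => (hmem u).toLp u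
  have hexp : 0 ≤ 1 / (ENNReal.ofReal r).toReal - 1 / p.toReal := by
    rcases eq_or_ne p ⊤ with rfl | hp
    · simp
    · rw [sub_nonneg]
      exact one_div_le_one_div_of_le (by rwa [ENNReal.toReal_ofReal hr0.le])
        (ENNReal.toReal_mono hp hrp)
  have hfin : μ univ ^ (1 / (ENNReal.ofReal r).toReal - 1 / p.toReal) ≠ ⊤ :=
    ENNReal.rpow_ne_top_of_nonneg hexp (measure_ne_top μ univ)
  have hT : LipschitzWith
      (μ univ ^ (1 / (ENNReal.ofReal r).toReal - 1 / p.toReal)).toNNReal T := by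
    intro u v
    rw [Lp.edist_toLp_toLp, Lp.edist_def, ENNReal.coe_toNNReal hfin, mul_comm]
    exact (eLpNorm_mono_measure _ hνμ).trans (eLpNorm_le_eLpNorm_mul_rpow_measure_univ hrp
      ((Lp.aestronglyMeasurable u).sub (Lp.aestronglyMeasurable v)))
  have hnorm : ∀ u : Lp ℝ p μ, ∫ x, |u x| ^ r ∂ν = ‖T u‖ ^ r := by
    intro u
    have hI : 0 ≤ ∫ x, ‖u x‖ ^ r ∂ν := integral_nonneg fun x => by positivity
    rw [Lp.norm_toLp, (hmem u).eLpNorm_eq_integral_rpow_norm (by positivity) ENNReal.ofReal_ne_top,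
      ENNReal.toReal_ofReal hr0.le, ENNReal.toReal_ofReal (by positivity),
      Real.rpow_inv_rpow hI hr0.ne']
    rfl
  simp_rw [hnorm]
  exact hT.continuous.norm.rpow_const fun _ => Or.inr hr0.le

lemma ae_eq_zero_of_integral_abs_rpow_eq_zero {α : Type*} [MeasurableSpace α] {ν : Measure α}
    {r : ℝ} (hr : 0 < r) {f : α → ℝ} (hf : MemLp f (ENNReal.ofReal r) ν)
    (h : ∫ x, |f x| ^ r ∂ν = 0) : f =ᵐ[ν] 0 := by
  have hint : Integrable (fun x => |f x| ^ r) ν := by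
    simpa [ENNReal.toReal_ofReal hr.le] using
      hf.integrable_norm_rpow (by simpa using hr) ENNReal.ofReal_ne_top
  rw [integral_eq_zero_iff_of_nonneg (fun x => by positivity) hint] at h
  filter_upwards [h] with x hx
  simpa [Real.rpow_eq_zero (abs_nonneg (f x)) hr.ne'] using hx

/-- If `Ω = Ω_N ∪ Ω_q ∪ Ω_p` is bounded with each piece of positive measure,
`m = max{β, q₂, ζ}` and `V` is a finite-dimensional subspace of `L^m(Ω)`, then there is
`C > 0` with `∫_{Ω_N}|u|^β + ∫_{Ω_q}|u|^{q₂} + ∫_{Ω_p}|u|^ζ ≥ C` for every `u ∈ V` of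
`L^m`-norm one. -/
theorem stmt15 (n : ℕ) (Ω ΩN Ωq Ωp : Set (EuclideanSpace ℝ (Fin n)))
    (hΩm : MeasurableSet Ω) (hΩNm : MeasurableSet ΩN) (hΩqm : MeasurableSet Ωq)
    (hΩpm : MeasurableSet Ωp)
    (hΩb : Bornology.IsBounded Ω)
    (hunion : Ω = ΩN ∪ Ωq ∪ Ωp)
    (hNpos : 0 < volume ΩN) (hqpos : 0 < volume Ωq) (hppos : 0 < volume Ωp)
    (β q₂ ζ : ℝ) (hβ : 1 ≤ β) (hq₂ : 1 ≤ q₂) (hζ : 1 ≤ ζ)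
    (m : ℝ) (hm : m = max β (max q₂ ζ))
    (V : Submodule ℝ (Lp ℝ (ENNReal.ofReal m) (volume.restrict Ω)))
    (hV : FiniteDimensional ℝ V) :
    ∃ C : ℝ, 0 < C ∧
      ∀ u : Lp ℝ (ENNReal.ofReal m) (volume.restrict Ω), u ∈ V → ‖u‖ = 1 →
        C ≤ (∫ x in ΩN, |u x| ^ β) + (∫ x in Ωq, |u x| ^ q₂) + ∫ x in Ωp, |u x| ^ ζ := by
  have hβm : ENNReal.ofReal β ≤ ENNReal.ofReal m :=
    ENNReal.ofReal_le_ofReal (hm ▸ le_max_left _ _)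
  have hqm : ENNReal.ofReal q₂ ≤ ENNReal.ofReal m :=
    ENNReal.ofReal_le_ofReal (hm ▸ (le_max_left _ _).trans (le_max_right _ _))
  have hζm : ENNReal.ofReal ζ ≤ ENNReal.ofReal m :=
    ENNReal.ofReal_le_ofReal (hm ▸ (le_max_right _ _).trans (le_max_right _ _))
  have : Fact (1 ≤ ENNReal.ofReal m) := ⟨le_trans (by simpa using hβ) hβm⟩
  have : IsFiniteMeasure (volume.restrict Ω) :=
    isFiniteMeasure_restrict.2 hΩb.measure_lt_top.ne
  have hN : volume.restrict ΩN ≤ volume.restrict Ω :=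
    Measure.restrict_mono (hunion ▸ (subset_union_left.trans subset_union_left)) le_rfl
  have hq : volume.restrict Ωq ≤ volume.restrict Ω :=
    Measure.restrict_mono (hunion ▸ (subset_union_right.trans subset_union_left)) le_rfl
  have hp : volume.restrict Ωp ≤ volume.restrict Ω :=
    Measure.restrict_mono (hunion ▸ subset_union_right) le_rfl
  let F : Lp ℝ (ENNReal.ofReal m) (volume.restrict Ω) → ℝ := fun u =>
    (∫ x in ΩN, |u x| ^ β) + (∫ x in Ωq, |u x| ^ q₂) + ∫ x in Ωp, |u x| ^ ζ
  have hF : Continuous F :=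
    ((continuous_integral_abs_rpow hN hβ hβm).add
      (continuous_integral_abs_rpow hq hq₂ hqm)).add (continuous_integral_abs_rpow hp hζ hζm)
  have hFpos : ∀ u, ‖u‖ = 1 → 0 < F u := by
    intro u hu
    have h1 : 0 ≤ ∫ x in ΩN, |u x| ^ β := integral_nonneg fun x => by positivity
    have h2 : 0 ≤ ∫ x in Ωq, |u x| ^ q₂ := integral_nonneg fun x => by positivity
    have h3 : 0 ≤ ∫ x in Ωp, |u x| ^ ζ := integral_nonneg fun x => by positivity
    refine lt_of_le_of_ne (by positivity) fun h0 => ?_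
    change 0 = (∫ x in ΩN, |u x| ^ β) + (∫ x in Ωq, |u x| ^ q₂) + ∫ x in Ωp, |u x| ^ ζ at h0
    have hzN := ae_eq_zero_of_integral_abs_rpow_eq_zero (by linarith)
      (memLp_coe_of_le hN hβm u) (by linarith)
    have hzq := ae_eq_zero_of_integral_abs_rpow_eq_zero (by linarith)
      (memLp_coe_of_le hq hqm u) (by linarith)
    have hzp := ae_eq_zero_of_integral_abs_rpow_eq_zero (by linarith)
      (memLp_coe_of_le hp hζm u) (by linarith)
    have hz : ∀ᵐ x ∂volume.restrict (ΩN ∪ Ωq ∪ Ωp), u x = 0 :=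
      (ae_restrict_union_iff _ _ _).2 ⟨(ae_restrict_union_iff _ _ _).2 ⟨hzN, hzq⟩, hzp⟩
    rw [← hunion] at hz
    have hu0 : u = 0 := (Lp.eq_zero_iff_ae_eq_zero).2 hz
    simp [hu0] at hu
  have : ProperSpace V := FiniteDimensional.proper_real V
  obtain ⟨C, hC, hCF⟩ := (isCompact_sphere (0 : V) 1).exists_forall_le'
    (hF.comp continuous_subtype_val).continuousOn (a := 0)
    fun v hv => hFpos v (by simpa using hv)
  exact ⟨C, hC, fun u huV hu => hCF ⟨u, huV⟩ (by simpa using hu)⟩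
end
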